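/- Let I be a monomial ideal of k[x_1,...,x_n] of height c. Then for every i ≥ 0, the i-th Betti number of S/I satisfies β_i(S/I) ≥ binom(c, i). -/

import Mathlib

open MvPolynomial

variable {k : Type} [Field k] {n : ℕ}

/-- An ideal of `k[x₁,…,xₙ]` is a *monomial ideal* if it is generated by monomials. -/
def IsMonomialIdeal (I : Ideal (MvPolynomial (Fin n) k)) : Prop :=
  ∃ G : Set (Fin n →₀ ℕ), I = Ideal.span ((fun A => (monomial A (1 : k))) '' G)

/-- The integral closure of an ideal `I`, as a set: all elements `f` satisfying an
equation `f^r + a₁ f^{r-1} + ⋯ + a_r = 0` with `aᵢ ∈ Iⁱ`. -/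
def intCl (I : Ideal (MvPolynomial (Fin n) k)) : Set (MvPolynomial (Fin n) k) :=
  {f | ∃ r : ℕ, 0 < r ∧ ∃ a : ℕ → MvPolynomial (Fin n) k,
    (∀ i, 1 ≤ i → i ≤ r → a i ∈ I ^ i) ∧
    f ^ r + ∑ i ∈ Finset.Icc 1 r, a i * f ^ (r - i) = 0}

/-- The exponent vectors of the minimal monomial generators of a set `T` of polynomials:
those `A` with `x^A ∈ T` minimal in the componentwise (divisibility) order. -/
def minExps (T : Set (MvPolynomial (Fin n) k)) : Set (Fin n →₀ ℕ) :=
  {A | monomial A (1 : k) ∈ T ∧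
    ∀ B : Fin n →₀ ℕ, monomial B (1 : k) ∈ T → B ≤ A → B = A}

/-- The height of an ideal: the infimum of the heights of the primes containing it. -/
noncomputable def idealHeight (I : Ideal (MvPolynomial (Fin n) k)) : ℕ∞ :=
  ⨅ p ∈ {q : PrimeSpectrum (MvPolynomial (Fin n) k) | I ≤ q.asIdeal}, Order.height p

namespace Koszul

open Finset

variable {ν R X Y : Type*} [LinearOrder ν] [CommRing R] [AddCommGroup X] [Module R X]
  [AddCommGroup Y] [Module R Y]

/-- The sign with which `j` is removed from `insert j τ`. -/
def sgn (R : Type*) [CommRing R] (j : ν) (τ : Finset ν) : R :=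
  (-1) ^ (τ.filter (· < j)).card

lemma sgn_mul_self (j : ν) (τ : Finset ν) : sgn R j τ * sgn R j τ = 1 := by
  rw [sgn, ← mul_pow]; simp

lemma sgn_insert_self (j : ν) (τ : Finset ν) : sgn R j (insert j τ) = sgn R j τ := by
  simp [sgn, filter_insert]

lemma sgn_erase_self (j : ν) (τ : Finset ν) : sgn R j (τ.erase j) = sgn R j τ := by
  unfold sgn
  congr 2
  ext l
  simp only [mem_filter, mem_erase]
  constructor
  · rintro ⟨⟨_, h⟩, h'⟩; exact ⟨h, h'⟩
  · rintro ⟨h, h'⟩; exact ⟨⟨h'.ne, h⟩, h'⟩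

lemma sgn_insert_of_lt {j l : ν} {τ : Finset ν} (hl : l ∉ τ) (h : l < j) :
    sgn R j (insert l τ) = -sgn R j τ := by
  simp [sgn, filter_insert, h, hl, pow_succ]

lemma sgn_insert_of_not_lt {j l : ν} {τ : Finset ν} (h : ¬ l < j) :
    sgn R j (insert l τ) = sgn R j τ := by
  simp [sgn, filter_insert, h]

lemma sgn_mul_sgn_insert {j l : ν} {τ : Finset ν} (hjl : j ≠ l) (hj : j ∉ τ) (hl : l ∉ τ) :
    sgn R j τ * sgn R l (insert j τ) = -(sgn R l τ * sgn R j (insert l τ)) := by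
  rcases lt_or_gt_of_ne hjl with h | h
  · rw [sgn_insert_of_lt hj h, sgn_insert_of_not_lt h.not_gt]; ring
  · rw [sgn_insert_of_lt hl h, sgn_insert_of_not_lt h.not_gt]; ring

/-- Contraction of Koszul chains with coefficients in `X` along the `j`-th basis vector. A chain
is a function on finite sets of indices. -/
def contr (R : Type*) [CommRing R] [Module R X] (j : ν) :
    (Finset ν → X) →ₗ[R] (Finset ν → X) where
  toFun f τ := if j ∈ τ then 0 else sgn R j τ • f (insert j τ)
  map_add' f g := by ext τ; by_cases h : j ∈ τ <;> simp [h]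
  map_smul' a f := by ext τ; by_cases h : j ∈ τ <;> simp [h, smul_comm a]

/-- Exterior multiplication of Koszul chains by the `j`-th basis vector. -/
def wedge (R : Type*) [CommRing R] [Module R X] (j : ν) :
    (Finset ν → X) →ₗ[R] (Finset ν → X) where
  toFun f τ := if j ∈ τ then sgn R j τ • f (τ.erase j) else 0
  map_add' f g := by ext τ; by_cases h : j ∈ τ <;> simp [h]
  map_smul' a f := by ext τ; by_cases h : j ∈ τ <;> simp [h, smul_comm a]

lemma contr_apply (j : ν) (f : Finset ν → X) (τ : Finset ν) :
    contr R j f τ = if j ∈ τ then 0 else sgn R j τ • f (insert j τ) := rfl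

lemma wedge_apply (j : ν) (f : Finset ν → X) (τ : Finset ν) :
    wedge R j f τ = if j ∈ τ then sgn R j τ • f (τ.erase j) else 0 := rfl

lemma contr_contr_self (j : ν) (f : Finset ν → X) : contr R j (contr R j f) = 0 := by
  ext τ; simp [contr_apply]

lemma contr_contr (j l : ν) (f : Finset ν → X) :
    contr R j (contr R l f) = -contr R l (contr R j f) := by
  rcases eq_or_ne j l with rfl | hjl
  · simp [contr_contr_self]
  ext τ
  by_cases hj : j ∈ τ
  · simp [contr_apply, hj]
  by_cases hl : l ∈ τ
  · simp [contr_apply, hl]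
  simp only [contr_apply, hj, hl, mem_insert, hjl, hjl.symm, or_self, if_false, smul_smul,
    Pi.neg_apply, sgn_mul_sgn_insert hjl hj hl, neg_smul, Finset.insert_comm j l]

lemma contr_wedge {j l : ν} (hjl : j ≠ l) (f : Finset ν → X) :
    contr R l (wedge R j f) = -wedge R j (contr R l f) := by
  ext τ
  by_cases hl : l ∈ τ
  · simp [contr_apply, wedge_apply, hl, hjl.symm]
  by_cases hj : j ∈ τ
  · obtain ⟨ρ, hρ, rfl⟩ : ∃ ρ, j ∉ ρ ∧ insert j ρ = τ := ⟨_, notMem_erase j τ, insert_erase hj⟩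
    have hl' : l ∉ ρ := fun h => hl (mem_insert_of_mem h)
    have e : (insert l (insert j ρ)).erase j = insert l ρ := by
      rw [Finset.insert_comm, erase_insert]; simp [hjl, hρ]
    simp only [contr_apply, wedge_apply, hl, hl', mem_insert, true_or, or_true, if_true, if_false,
      erase_insert hρ, smul_smul, Pi.neg_apply, e, sgn_insert_self]
    rw [← neg_smul]
    congr 1
    rw [Finset.insert_comm, sgn_insert_self]
    have h := sgn_mul_sgn_insert (R := R) hjl hρ hl'
    have h1 := sgn_mul_self (R := R) j ρ
    have h2 := sgn_mul_self (R := R) l ρ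
    have h3 := sgn_mul_self (R := R) j (insert l ρ)
    linear_combination (sgn R j ρ * sgn R j (insert l ρ)) * h -
      (sgn R l (insert j ρ) * sgn R j (insert l ρ)) * h1 - sgn R j ρ * sgn R l ρ * h3
  · simp [contr_apply, wedge_apply, hj, hl, hjl]

lemma contr_wedge_self {j : ν} {f : Finset ν → X} (hf : ∀ τ, j ∈ τ → f τ = 0) :
    contr R j (wedge R j f) = f := by
  ext τ
  by_cases hj : j ∈ τ
  · simp [contr_apply, hj, hf]
  · simp [contr_apply, wedge_apply, hj, smul_smul, sgn_insert_self, sgn_mul_self]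

/-- The Koszul differential on the elements `x j`, `j ∈ Q`. -/
def diff (x : ν → R) (Q : Finset ν) : (Finset ν → X) →ₗ[R] (Finset ν → X) :=
  ∑ j ∈ Q, x j • contr R j

lemma diff_apply (x : ν → R) (Q : Finset ν) (f : Finset ν → X) :
    diff x Q f = ∑ j ∈ Q, x j • contr R j f := by
  simp [diff]

lemma diff_insert (x : ν → R) {Q : Finset ν} {j : ν} (hj : j ∉ Q) (f : Finset ν → X) :
    diff x (insert j Q) f = x j • contr R j f + diff x Q f := by
  simp [diff_apply, sum_insert hj]

lemma diff_contr (x : ν → R) (Q : Finset ν) (j : ν) (f : Finset ν → X) :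
    diff x Q (contr R j f) = -contr R j (diff x Q f) := by
  simp [diff_apply, contr_contr _ j]

lemma diff_wedge (x : ν → R) {Q : Finset ν} {j : ν} (hj : j ∉ Q) (f : Finset ν → X) :
    diff x Q (wedge R j f) = -wedge R j (diff x Q f) := by
  simp only [diff_apply, map_sum, map_smul, ← sum_neg_distrib]
  refine sum_congr rfl fun l hl => ?_
  rw [contr_wedge (by rintro rfl; exact hj hl), smul_neg]

lemma diff_diff (x : ν → R) (Q : Finset ν) (f : Finset ν → X) : diff x Q (diff x Q f) = 0 := by
  induction Q using Finset.induction_on with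
  | empty => simp [diff_apply]
  | insert j Q hj ih =>
    simp [diff_insert x hj, contr_contr_self, diff_contr, ih]

lemma map_diff (φ : X →ₗ[R] Y) (x : ν → R) (Q : Finset ν) (f : Finset ν → X) (τ : Finset ν) :
    φ (diff x Q f τ) = diff x Q (fun ρ => φ (f ρ)) τ := by
  simp only [diff_apply, Finset.sum_apply, Pi.smul_apply, map_sum, map_smul]
  refine sum_congr rfl fun j _ => ?_
  by_cases h : j ∈ τ <;> simp [contr_apply, h]

/-- The Koszul chains of degree `p` on the elements indexed by `Q`. -/
def chains (R X : Type*) [CommRing R] [AddCommGroup X] [Module R X] (Q : Finset ν) (p : ℕ) :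
    Submodule R (Finset ν → X) where
  carrier := {f | ∀ τ, ¬ (τ ⊆ Q ∧ τ.card = p) → f τ = 0}
  add_mem' hf hg τ h := by simp [hf τ h, hg τ h]
  zero_mem' _ _ := rfl
  smul_mem' a f hf τ h := by simp [hf τ h]

lemma contr_mem_chains {Q : Finset ν} {p : ℕ} {f : Finset ν → X} {j : ν}
    (hf : f ∈ chains R X (insert j Q) (p + 1)) : contr R j f ∈ chains R X Q p := by
  intro τ hτ
  by_cases hj : j ∈ τ
  · simp [contr_apply, hj]
  rw [contr_apply, if_neg hj, hf, smul_zero]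
  rintro ⟨h1, h2⟩
  rw [card_insert_of_notMem hj] at h2
  refine hτ ⟨fun l hl => ?_, by omega⟩
  exact mem_of_mem_insert_of_ne (h1 (mem_insert_of_mem hl)) (by rintro rfl; exact hj hl)

omit [LinearOrder ν] in
lemma chains_mono {P Q : Finset ν} (h : P ⊆ Q) (p : ℕ) : chains R X P p ≤ chains R X Q p :=
  fun _ hf τ hτ => hf τ fun h' => hτ ⟨h'.1.trans h, h'.2⟩

lemma wedge_mem_chains {Q : Finset ν} {p : ℕ} {f : Finset ν → X} {j : ν}
    (hf : f ∈ chains R X Q p) : wedge R j f ∈ chains R X (insert j Q) (p + 1) := by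
  intro τ hτ
  by_cases h : j ∈ τ
  · rw [wedge_apply, if_pos h, hf, smul_zero]
    rintro ⟨h1, h2⟩
    refine hτ ⟨by rwa [← subset_insert_iff] at h1, ?_⟩
    rw [← card_erase_add_one h, h2]
  · simp [wedge_apply, h]

lemma diff_mem_chains (x : ν → R) {Q : Finset ν} {p : ℕ} {f : Finset ν → X}
    (hf : f ∈ chains R X Q (p + 1)) : diff x Q f ∈ chains R X Q p := by
  rw [diff_apply]
  refine Submodule.sum_mem _ fun j hj => Submodule.smul_mem _ _ (contr_mem_chains ?_)
  rwa [insert_eq_of_mem hj]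

omit [LinearOrder ν] in
lemma apply_eq_zero_of_mem_chains {Q : Finset ν} {p : ℕ} {f : Finset ν → X} {j : ν} (hj : j ∉ Q)
    (hf : f ∈ chains R X Q p) (τ : Finset ν) (h : j ∈ τ) : f τ = 0 :=
  hf τ fun h' => hj (h'.1 h)

lemma eq_add_wedge {Q : Finset ν} {p : ℕ} {f : Finset ν → X} {j : ν}
    (hf : f ∈ chains R X (insert j Q) p) :
    ∃ u ∈ chains R X Q p, f = u + wedge R j (contr R j f) := by
  refine ⟨fun τ => if j ∈ τ then 0 else f τ, fun τ hτ => ?_, ?_⟩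
  · by_cases h : j ∈ τ
    · simp [h]
    · simp only [h, if_false]
      refine hf τ fun h' => hτ ⟨?_, h'.2⟩
      exact (subset_insert_iff_of_notMem h).1 h'.1
  · ext τ
    by_cases h : j ∈ τ
    · simp [h, wedge_apply, contr_apply, smul_smul, sgn_erase_self, sgn_mul_self]
    · simp [h, wedge_apply]

/-- `u` lies in the submodule generated by the elements `x j • X`, `j ∈ Q`. -/
def InIdealSMul (x : ν → R) (Q : Finset ν) (u : X) : Prop :=
  ∃ g : ν → X, u = ∑ j ∈ Q, x j • g j

/-- The family `x j`, `j ∈ P`, is a regular sequence on `X` in every order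
(except that the quotient by it may vanish). -/
def IsPermRegular (x : ν → R) (P : Finset ν) (X : Type*) [AddCommGroup X] [Module R X] : Prop :=
  ∀ Q ⊆ P, ∀ j ∈ P, j ∉ Q → ∀ u : X, InIdealSMul x Q (x j • u) → InIdealSMul x Q u

lemma inIdealSMul_diff (x : ν → R) (Q : Finset ν) (f : Finset ν → X) (τ : Finset ν) :
    InIdealSMul x Q (diff x Q f τ) :=
  ⟨fun j => contr R j f τ, by simp [diff_apply]⟩

lemma InIdealSMul.exists_diff {x : ν → R} {Q : Finset ν} {f : Finset ν → X}
    (hf : f ∈ chains R X Q 0) (h : InIdealSMul x Q (f ∅)) :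
    ∃ g ∈ chains R X Q 1, diff x Q g = f := by
  obtain ⟨g, hg⟩ := h
  have hmem : (fun τ : Finset ν => if τ.card = 1 then ∑ j ∈ τ with j ∈ Q, g j else 0) ∈
      chains R X Q 1 := by
    intro τ hτ
    by_cases h1 : τ.card = 1
    · obtain ⟨j, rfl⟩ := card_eq_one.1 h1
      have : j ∉ Q := fun h => hτ ⟨singleton_subset_iff.2 h, h1⟩
      simp [filter_singleton, this]
    · simp [h1]
  refine ⟨_, hmem, ?_⟩
  ext τ
  by_cases hτ : τ = ∅
  · subst hτ
    rw [hg, diff_apply, Finset.sum_apply]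
    refine sum_congr rfl fun j hj => ?_
    simp [contr_apply, sgn, filter_singleton, hj]
  · have hτ' : ¬ (τ ⊆ Q ∧ τ.card = 0) := fun h => hτ (card_eq_zero.1 h.2)
    rw [hf τ hτ', diff_mem_chains x hmem τ hτ']

/-- The Koszul complex is exact in positive degrees. -/
lemma exists_diff_eq {x : ν → R} {P : Finset ν} (hx : IsPermRegular x P X) {Q : Finset ν}
    (hQ : Q ⊆ P) (p : ℕ) {f : Finset ν → X} (hf : f ∈ chains R X Q (p + 1))
    (hd : diff x Q f = 0) : ∃ g ∈ chains R X Q (p + 2), diff x Q g = f := by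
  induction Q using Finset.induction_on generalizing p f with
  | empty =>
    refine ⟨0, Submodule.zero_mem _, ?_⟩
    ext τ
    rw [hf τ]
    · simp
    · rintro ⟨h, h'⟩
      simp [subset_empty.1 h] at h'
  | insert j Q hj ih =>
    have hQ' : Q ⊆ P := (subset_insert j Q).trans hQ
    obtain ⟨u, hu, hfu⟩ := eq_add_wedge hf
    set v := contr R j f with hv
    have hvm : v ∈ chains R X Q p := contr_mem_chains hf
    have hdv : diff x Q v = 0 := by
      rw [diff_contr]
      have := congrArg (contr R j) hd
      simpa [diff_insert x hj, contr_contr_self] using this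
    have hdu : diff x Q u = -(x j • v) := by
      rw [diff_insert x hj, ← hv, hfu, map_add, diff_wedge x hj, hdv] at hd
      rw [eq_neg_iff_add_eq_zero, add_comm]
      simpa using hd
    obtain ⟨v', hv'm, hv'⟩ : ∃ v' ∈ chains R X Q (p + 1), diff x Q v' = v := by
      cases p with
      | zero =>
        refine InIdealSMul.exists_diff hvm
          (hx Q hQ' j (hQ (mem_insert_self j Q)) hj _ ?_)
        have := inIdealSMul_diff x Q (-u) ∅
        rwa [map_neg, hdu, neg_neg] at this
      | succ p => exact ih hQ' p hvm hdv
    obtain ⟨u', hu'm, hu'⟩ := ih hQ' p (f := u + x j • v')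
      (Submodule.add_mem _ hu (Submodule.smul_mem _ _ hv'm)) (by simp [hdu, hv'])
    refine ⟨u' - wedge R j v', Submodule.sub_mem _ (chains_mono (subset_insert j Q) _ hu'm)
      (wedge_mem_chains hv'm), ?_⟩
    have hcu' : contr R j u' = 0 := by
      ext τ
      by_cases h : j ∈ τ
      · simp [contr_apply, h]
      · simp [contr_apply, h, apply_eq_zero_of_mem_chains hj hu'm (insert j τ)]
    rw [diff_insert x hj, map_sub, map_sub, diff_wedge x hj, hcu', hv', hu',
      contr_wedge_self (apply_eq_zero_of_mem_chains hj hv'm), hfu]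
    simp only [smul_sub, smul_zero]
    abel

lemma exists_lift_chains {φ : X →ₗ[R] Y} (hφ : Function.Surjective φ) {P : Finset ν} {p : ℕ}
    {m : Finset ν → Y} (hm : m ∈ chains R Y P p) :
    ∃ f ∈ chains R X P p, ∀ τ, φ (f τ) = m τ := by
  classical
  refine ⟨fun τ => if τ ⊆ P ∧ τ.card = p then Function.surjInv hφ (m τ) else 0,
    fun τ hτ => by simp [hτ], fun τ => ?_⟩
  by_cases hτ : τ ⊆ P ∧ τ.card = p
  · simp [hτ, Function.surjInv_eq]
  · simp [hτ, hm τ hτ]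

/-- Koszul cycles with coefficients in `M` lift to the terms of a resolution of `M`, in such a
way that a relation modulo the ideal `(x j)` between the lifts comes from a relation
modulo boundaries between the cycles. -/
theorem exists_lift_resolution {R : Type} [CommRing R] {s : Type*} [Fintype s] (x : ν → R)
    (P : Finset ν) (i : ℕ) :
    ∀ (M : Type) [AddCommGroup M] [Module R M] (F : ℕ → Type) [∀ q, AddCommGroup (F q)]
      [∀ q, Module R (F q)] (π : F 0 →ₗ[R] M) (d : ∀ q, F (q + 1) →ₗ[R] F q),
      (∀ q, IsPermRegular x P (F q)) → Function.Surjective π →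
      LinearMap.ker π = LinearMap.range (d 0) →
      (∀ q, LinearMap.ker (d q) = LinearMap.range (d (q + 1))) →
      ∀ m : s → Finset ν → M, (∀ a, m a ∈ chains R M P i) → (∀ a, diff x P (m a) = 0) →
      ∃ z : s → F i, ∀ b : s → R, InIdealSMul x P (∑ a, b a • z a) →
        ∃ g ∈ chains R M P (i + 1), diff x P g = ∑ a, b a • m a := by
  induction i with
  | zero =>
    intro M _ _ F _ _ π d hF hπ h0 hd m hm hdm
    choose z hz using fun a => hπ (m a ∅)
    refine ⟨z, fun b ⟨g, hg⟩ => InIdealSMul.exists_diff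
      (Submodule.sum_mem _ fun a _ => Submodule.smul_mem _ _ (hm a)) ⟨fun j => π (g j), ?_⟩⟩
    simpa [hz] using congrArg π hg
  | succ i ih =>
    intro M _ _ F _ _ π d hF hπ h0 hd m hm hdm
    choose f hf hfm using fun a => exists_lift_chains hπ (hm a)
    have hfm' : ∀ a, (fun τ => π (f a τ)) = m a := fun a => funext (hfm a)
    have hker : ∀ a τ, diff x P (f a) τ ∈ LinearMap.ker π := fun a τ => by
      rw [LinearMap.mem_ker, map_diff, hfm', hdm]; rfl
    have hd0 : ∀ y, d 0 y ∈ LinearMap.ker π := fun y => h0 ▸ LinearMap.mem_range_self _ y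
    obtain ⟨z, hz⟩ := ih (LinearMap.ker π) (fun q => F (q + 1)) ((d 0).codRestrict _ hd0)
      (fun q => d (q + 1)) (fun q => hF (q + 1))
      (fun ⟨y, hy⟩ => by
        rw [h0] at hy
        obtain ⟨y', rfl⟩ := hy
        exact ⟨y', rfl⟩)
      (by rw [LinearMap.ker_codRestrict, hd 0]) (fun q => hd (q + 1))
      (fun a τ => ⟨diff x P (f a) τ, hker a τ⟩)
      (fun a τ hτ => Subtype.ext (diff_mem_chains x (hf a) τ hτ))
      (fun a => funext fun τ => Subtype.ext (by
        have := map_diff (LinearMap.ker π).subtype x P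
          (fun τ => (⟨diff x P (f a) τ, hker a τ⟩ : LinearMap.ker π)) τ
        simp only [Submodule.subtype_apply] at this
        rw [this]
        exact congrFun (diff_diff x P (f a)) τ))
    refine ⟨z, fun b hb => ?_⟩
    obtain ⟨g, hg, hgb⟩ := hz b hb
    have hg' : (fun τ => (g τ : F 0)) ∈ chains R (F 0) P (i + 1) := fun τ hτ => by
      simp [hg τ hτ]
    have hcyc : diff x P (∑ a, b a • f a - fun τ => (g τ : F 0)) = 0 := by
      rw [map_sub, sub_eq_zero]
      ext τ
      have h1 := map_diff (LinearMap.ker π).subtype x P g τ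
      simp only [Submodule.subtype_apply] at h1
      rw [← h1, hgb]
      simp
    obtain ⟨h, hh, hhd⟩ := exists_diff_eq (hF 0) subset_rfl i
      (Submodule.sub_mem _ (Submodule.sum_mem _ fun a _ => Submodule.smul_mem _ (b a) (hf a)) hg')
      hcyc
    refine ⟨fun τ => π (h τ), fun τ hτ => by simp [hh τ hτ], ?_⟩
    ext τ
    rw [← map_diff, hhd]
    simp [hfm]

/-- Only the elements `x j` with `j ∉ τ` contribute to the `τ`-component of a boundary. -/
lemma inIdealSMul_diff_apply_sdiff (x : ν → R) (P : Finset ν) (f : Finset ν → X)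
    (τ : Finset ν) : InIdealSMul x (P \ τ) (diff x P f τ) := by
  refine ⟨fun j => contr R j f τ, ?_⟩
  rw [diff_apply, Finset.sum_apply]
  refine (sum_subset sdiff_subset fun j hj hjτ => ?_).symm
  have : j ∈ τ := by simpa [hj] using hjτ
  simp [contr_apply, this]

end Koszul

namespace MvPolynomial

variable {κ : Type*} {K : Type*} [Field K]

lemma ker_aeval_ite_eq_span_X_image (s : Set κ) [DecidablePred (· ∈ s)] :
    RingHom.ker (aeval (R := K) fun j => if j ∈ s then (0 : MvPolynomial κ K) else X j) =
      Ideal.span (X '' s) := by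
  refine le_antisymm (fun f hf => ?_) (Ideal.span_le.2 ?_)
  · rw [← Ideal.Quotient.eq_zero_iff_mem]
    have h : (Ideal.Quotient.mkₐ K (Ideal.span (X '' s))).comp
        (aeval (R := K) fun j => if j ∈ s then (0 : MvPolynomial κ K) else X j) =
        Ideal.Quotient.mkₐ K (Ideal.span (X '' s)) := by
      ext j
      by_cases hj : j ∈ s
      · simpa [hj] using
          (Ideal.Quotient.eq_zero_iff_mem.2 (Ideal.subset_span (Set.mem_image_of_mem X hj))).symm
      · simp [hj]
    have := DFunLike.congr_fun h f
    rw [AlgHom.comp_apply, (RingHom.mem_ker).1 hf, map_zero] at this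
    exact this.symm
  · rintro _ ⟨j, hj, rfl⟩
    simp [RingHom.mem_ker, hj]

lemma isPrime_span_X_image (s : Set κ) :
    (Ideal.span (X '' s : Set (MvPolynomial κ K))).IsPrime := by
  classical
  rw [← ker_aeval_ite_eq_span_X_image]
  exact RingHom.ker_isPrime _

lemma X_mem_span_X_image_iff {s : Set κ} {j : κ} :
    (X j : MvPolynomial κ K) ∈ Ideal.span (X '' s) ↔ j ∈ s := by
  classical
  rw [mem_ideal_span_X_image]
  simp [support_X, Finsupp.single_apply]

lemma monomial_mem_span_monomial_image_iff {G : Set (κ →₀ ℕ)} {m : κ →₀ ℕ} :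
    monomial m (1 : K) ∈ Ideal.span ((fun A => monomial A (1 : K)) '' G) ↔ ∃ g ∈ G, g ≤ m := by
  classical
  rw [mem_ideal_span_monomial_image]
  simp [support_monomial]

lemma span_monomial_image_le_span_X_image_iff {G : Set (κ →₀ ℕ)} {s : Set κ} :
    Ideal.span ((fun A => monomial A (1 : K)) '' G) ≤ Ideal.span (X '' s) ↔
      ∀ g ∈ G, ∃ l ∈ s, g l ≠ 0 := by
  classical
  simp [Ideal.span_le, Set.subset_def, mem_ideal_span_X_image]

/-- The variables generating a minimal prime over a proper monomial ideal. -/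
lemma exists_minimal_cover [Fintype κ] {G : Set (κ →₀ ℕ)} (hG : 0 ∉ G) :
    ∃ P : Finset κ, (∀ g ∈ G, ∃ l ∈ P, g l ≠ 0) ∧
      ∀ j ∈ P, ∃ g ∈ G, ∀ l ∈ P, l ≠ j → g l = 0 := by
  classical
  have hne : (Finset.univ.filter fun P : Finset κ => ∀ g ∈ G, ∃ l ∈ P, g l ≠ 0).Nonempty := by
    refine ⟨Finset.univ, ?_⟩
    simp only [Finset.mem_filter, Finset.mem_univ, true_and]
    intro g hg
    by_contra! h
    exact hG ((Finsupp.ext h : g = 0) ▸ hg)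
  obtain ⟨P, hP⟩ := Finset.exists_minimal hne
  have hP1 := hP.prop
  simp only [Finset.mem_filter, Finset.mem_univ, true_and] at hP1
  refine ⟨P, hP1, fun j hj => ?_⟩
  by_contra! h
  refine Finset.notMem_erase j P (hP.le_of_le (y := P.erase j) ?_ (Finset.erase_subset j P) hj)
  simp only [Finset.mem_filter, Finset.mem_univ, true_and]
  intro g hg
  obtain ⟨l, hl, hlj, hgl⟩ := h g hg
  exact ⟨l, Finset.mem_erase.2 ⟨hlj, hl⟩, hgl⟩

/-- For each set `σ` of variables in a minimal prime `P` over a monomial ideal, some monomial is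
a socle element in the directions of `σ`, and its annihilator modulo the other variables of `P`
is contained in `P`. -/
lemma exists_socle_monomial [Fintype κ] [DecidableEq κ] {G : Set (κ →₀ ℕ)} {P σ : Finset κ}
    (hP : ∀ g ∈ G, ∃ l ∈ P, g l ≠ 0)
    (hmin : ∀ j ∈ P, ∃ g ∈ G, ∀ l ∈ P, l ≠ j → g l = 0) (hσ : σ ⊆ P) :
    ∃ w : κ →₀ ℕ,
      (∀ j ∈ σ, X j * monomial w (1 : K) ∈ Ideal.span ((fun A => monomial A (1 : K)) '' G)) ∧
      ∀ c : MvPolynomial κ K,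
        c * monomial w 1 ∈ Ideal.span ((fun A => monomial A (1 : K)) '' G) ⊔
          Ideal.span (X '' (↑(P \ σ) : Set κ)) →
        c ∈ Ideal.span (X '' (P : Set κ)) := by
  choose! m hmG hm using hmin
  let q : (κ →₀ ℕ) → Prop := fun a => ∃ b : κ →₀ ℕ, (∀ l ∈ P, b l = 0) ∧ ∃ g ∈ G, g ≤ a + b
  let A : Set (κ →₀ ℕ) := {a | (∀ l ∉ σ, a l = 0) ∧ ¬ q a}
  have hfin : A.Finite := by
    refine (Set.finite_Icc 0 (Finsupp.equivFunOnFinite.symm fun j => m j j)).subset ?_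
    rintro a ⟨ha, hqa⟩
    refine ⟨zero_le, fun j => ?_⟩
    by_cases hj : j ∈ σ
    · by_contra! h
      refine hqa ⟨(m j).filter (· ∉ P), fun l hl => by simp [hl], m j, hmG j (hσ hj), fun l => ?_⟩
      by_cases hl : l ∈ P
      · rcases eq_or_ne l j with rfl | hlj
        · simpa [hl] using h.le
        · simp [hm j (hσ hj) l hl hlj]
      · simp [hl]
    · simp [ha j hj]
  have hne : A.Nonempty := by
    refine ⟨0, fun _ _ => rfl, ?_⟩
    rintro ⟨b, hb, g, hg, hgb⟩
    obtain ⟨l, hl, hgl⟩ := hP g hg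
    have := hgb l
    simp only [zero_add, hb l hl] at this
    omega
  obtain ⟨a, ha⟩ := hfin.exists_maximal hne
  obtain ⟨haσ, haq⟩ := ha.prop
  have hstep : ∀ j ∈ σ, q (a + Finsupp.single j 1) := by
    intro j hj
    by_contra h
    have hmem : a + Finsupp.single j 1 ∈ A := by
      refine ⟨fun l hl => ?_, h⟩
      have : j ≠ l := by rintro rfl; exact hl hj
      simp [haσ l hl, this]
    have := ha.le_of_ge hmem le_self_add j
    simp at this
  choose! b hbP g hgG hg using hstep
  have hB : ∀ l ∈ P, (∑ j ∈ σ, b j) l = 0 := fun l hl => by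
    rw [Finsupp.finsetSum_apply]
    exact Finset.sum_eq_zero fun j hj => hbP j hj l hl
  refine ⟨a + ∑ j ∈ σ, b j, fun j hj => ?_, fun c hc => ?_⟩
  · rw [X, monomial_mul, one_mul, monomial_mem_span_monomial_image_iff]
    refine ⟨g j, hgG j hj, (hg j hj).trans ?_⟩
    have := Finset.single_le_sum (f := b) (fun _ _ => zero_le) hj
    calc a + Finsupp.single j 1 + b j = Finsupp.single j 1 + (a + b j) := by abel
      _ ≤ _ := by gcongr
  · by_contra hcP
    rw [mem_ideal_span_X_image] at hcP
    push Not at hcP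
    obtain ⟨e, he, heP⟩ := hcP
    have himg : (X '' (↑(P \ σ) : Set κ) : Set (MvPolynomial κ K)) =
        (fun A => monomial A (1 : K)) '' ((fun l => Finsupp.single l 1) '' ↑(P \ σ)) := by
      rw [Set.image_image]; rfl
    rw [himg, ← Ideal.span_union, ← Set.image_union, mem_ideal_span_monomial_image] at hc
    obtain ⟨s, hs, hse⟩ := hc (e + (a + ∑ j ∈ σ, b j)) (by
      rw [mem_support_iff, coeff_mul_monomial, mul_one]
      exact mem_support_iff.1 he)
    rcases hs with hs | ⟨l, hl, rfl⟩
    · refine haq ⟨e + ∑ j ∈ σ, b j, fun l hl => ?_, s, hs, hse.trans (le_of_eq (by abel))⟩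
      simp only [Finsupp.add_apply, heP l hl, hB l hl]
    · obtain ⟨hlP, hlσ⟩ := Finset.mem_sdiff.1 (Finset.mem_coe.1 hl)
      have := hse l
      simp only [Finsupp.add_apply, heP l hlP, hB l hlP, haσ l hlσ] at this
      simp at this

lemma inIdealSMul_X_iff {ρ : Type*} [Finite ρ] {Q : Finset κ} {u : ρ →₀ MvPolynomial κ K} :
    Koszul.InIdealSMul (X : κ → MvPolynomial κ K) Q u ↔
      ∀ t, u t ∈ Ideal.span (X '' (Q : Set κ)) := by
  constructor
  · rintro ⟨g, rfl⟩ t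
    rw [Finsupp.finsetSum_apply]
    refine Ideal.sum_mem _ fun j hj => ?_
    rw [Finsupp.smul_apply, smul_eq_mul]
    exact Ideal.mul_mem_right _ _ (Ideal.subset_span (Set.mem_image_of_mem X hj))
  · intro h
    choose c hc using fun t => (Submodule.mem_span_image_finset_iff_exists_fun' _).1 (h t)
    refine ⟨fun j => Finsupp.equivFunOnFinite.symm fun t => c t j, ?_⟩
    ext1 t
    rw [Finsupp.finsetSum_apply, ← hc]
    exact Finset.sum_congr rfl fun j _ => mul_comm _ _

lemma isPermRegular_X [LinearOrder κ] (P : Finset κ) (ρ : Type*) [Finite ρ] :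
    Koszul.IsPermRegular (X : κ → MvPolynomial κ K) P (ρ →₀ MvPolynomial κ K) := by
  intro Q _ j _ hj u hu
  rw [inIdealSMul_X_iff] at hu ⊢
  refine fun t => ((isPrime_span_X_image _).mem_or_mem (hu t)).resolve_left fun h => hj ?_
  exact X_mem_span_X_image_iff.1 h

end MvPolynomial

lemma idealHeight_le_card {K : Type} [Field K] {N : ℕ} {I : Ideal (MvPolynomial (Fin N) K)}
    {P : Finset (Fin N)} (h : I ≤ Ideal.span (X '' (P : Set (Fin N)))) :
    idealHeight I ≤ P.card := by
  classical
  have hp := isPrime_span_X_image (K := K) (P : Set (Fin N))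
  refine (iInf₂_le (⟨_, hp⟩ : PrimeSpectrum (MvPolynomial (Fin N) K)) h).trans ?_
  rw [← PrimeSpectrum.height_eq_orderHeight]
  have h1 := Ideal.height_le_card_of_mem_minimalPrimes_span_finset
    (p := Ideal.span (X '' (P : Set (Fin N)) : Set (MvPolynomial (Fin N) K))) (s := P.image X) (by
      rw [Finset.coe_image]
      exact ⟨⟨hp, le_rfl⟩, fun q hq _ => hq.2⟩)
  exact h1.trans (Nat.cast_le.2 Finset.card_image_le)

lemma zero_notMem_of_idealHeight_ne_top {K : Type} [Field K] {N : ℕ} {G : Set (Fin N →₀ ℕ)}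
    (h : idealHeight (Ideal.span ((fun A => monomial A (1 : K)) '' G)) ≠ ⊤) : 0 ∉ G := by
  intro h0
  refine h (iInf₂_eq_top.2 fun p hp => absurd ?_ p.isPrime.ne_top)
  exact (Ideal.eq_top_iff_one _).2 (hp (Ideal.subset_span ⟨0, h0, rfl⟩))

/-- Let `I` be a monomial ideal of height `c`. Then `β_i(S/I) ≥ C(c,i)`
for all `i`. The Betti numbers are encoded by a minimal free resolution of `S/I`:
a complex of finite free modules `F i = (ι i →₀ S)` with differentials `d i`, an
augmentation `π : F 0 → S/I`, exactness, and minimality (all differentials, and `ker π`,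
land in `m·F`, i.e. all coordinates have zero constant term); then
`β_i(S/I) = card (ι i)`, and the claim is `C(c,i) ≤ card (ι i)`. -/
theorem betti_ge_choose_height (I : Ideal (MvPolynomial (Fin n) k))
    (hI : IsMonomialIdeal I) (c : ℕ) (hht : idealHeight I = (c : ℕ∞))
    (ι : ℕ → Type) [∀ i, Fintype (ι i)]
    (π : (ι 0 →₀ MvPolynomial (Fin n) k) →ₗ[MvPolynomial (Fin n) k]
      (MvPolynomial (Fin n) k ⧸ I))
    (hπ : Function.Surjective π)
    (d : (i : ℕ) → ((ι (i + 1) →₀ MvPolynomial (Fin n) k) →ₗ[MvPolynomial (Fin n) k]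
      (ι i →₀ MvPolynomial (Fin n) k)))
    (hex0 : LinearMap.ker π = LinearMap.range (d 0))
    (hex : ∀ i, LinearMap.ker (d i) = LinearMap.range (d (i + 1)))
    (hmin0 : ∀ x ∈ LinearMap.ker π, ∀ t, MvPolynomial.coeff 0 (x t) = 0)
    (hmind : ∀ i x t, MvPolynomial.coeff 0 ((d i x) t) = 0) :
    ∀ i, Nat.choose c i ≤ Fintype.card (ι i) := by
  obtain ⟨G, rfl⟩ := hI
  obtain ⟨P, hP, hPmin⟩ :=
    exists_minimal_cover (zero_notMem_of_idealHeight_ne_top (hht ▸ ENat.natCast_ne_top c))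
  have hle := span_monomial_image_le_span_X_image_iff (K := k) (s := (P : Set (Fin n))) |>.2 hP
  have hcP : c ≤ P.card := by exact_mod_cast hht ▸ idealHeight_le_card hle
  intro i
  refine (Nat.choose_le_choose i hcP).trans ?_
  let S := MvPolynomial (Fin n) k
  let I : Ideal S := Ideal.span ((fun A => monomial A (1 : k)) '' G)
  let p : Ideal S := Ideal.span (X '' (P : Set (Fin n)))
  have hp : p.IsPrime := isPrime_span_X_image _
  have hs : ∀ σ : P.powersetCard i, (σ : Finset (Fin n)) ⊆ P ∧ (σ : Finset (Fin n)).card = i :=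
    fun σ => Finset.mem_powersetCard.1 σ.2
  choose w hw hwann using fun σ : P.powersetCard i =>
    exists_socle_monomial (K := k) hP hPmin (hs σ).1
  let m : P.powersetCard i → Finset (Fin n) → S ⧸ I := fun σ =>
    Pi.single (σ : Finset (Fin n)) (Ideal.Quotient.mk I (monomial (w σ) 1))
  have hm : ∀ σ, m σ ∈ Koszul.chains S (S ⧸ I) P i := fun σ τ hτ =>
    Pi.single_eq_of_ne (by rintro rfl; exact hτ (hs σ)) _
  have hdm : ∀ σ, Koszul.diff (X : Fin n → S) P (m σ) = 0 := by
    intro σ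
    rw [Koszul.diff_apply]
    refine Finset.sum_eq_zero fun j _ => funext fun τ => ?_
    rw [Pi.smul_apply, Koszul.contr_apply, Pi.zero_apply]
    by_cases hj : j ∈ τ
    · simp [hj]
    by_cases hτ : insert j τ = σ
    · have hjσ : j ∈ (σ : Finset (Fin n)) := hτ ▸ Finset.mem_insert_self j τ
      have h0 : (X j : S) • m σ (insert j τ) = 0 := by
        rw [hτ]
        simp only [m, Pi.single_eq_same]
        exact Ideal.Quotient.eq_zero_iff_mem.2 (hw σ j hjσ)
      rw [if_neg hj, smul_comm, h0, smul_zero]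
    · simp only [m, hj, if_false, Pi.single_eq_of_ne hτ, smul_zero]
  obtain ⟨z, hz⟩ := Koszul.exists_lift_resolution (X : Fin n → S) P i (S ⧸ I)
    (fun q => ι q →₀ S) π d (fun q => isPermRegular_X P (ι q)) hπ hex0 hex m hm hdm
  have hli : LinearIndependent (S ⧸ p)
      (fun (σ : P.powersetCard i) (t : ι i) => Ideal.Quotient.mk p (z σ t)) := by
    rw [Fintype.linearIndependent_iff]
    intro b hb σ
    choose b' hb' using fun σ => Ideal.Quotient.mk_surjective (b σ)
    obtain ⟨g, -, hg⟩ := hz b' (inIdealSMul_X_iff.2 fun t => by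
      change _ ∈ p
      rw [← Ideal.Quotient.eq_zero_iff_mem, Finsupp.finsetSum_apply, map_sum]
      simpa [hb'] using congrFun hb t)
    rw [← hb', Ideal.Quotient.eq_zero_iff_mem]
    refine hwann σ _ ?_
    obtain ⟨h, hh⟩ := Koszul.inIdealSMul_diff_apply_sdiff (X : Fin n → S) P g σ
    have hsum : (∑ τ, b' τ • m τ) (σ : Finset (Fin n)) =
        Ideal.Quotient.mk I (b' σ * monomial (w σ) 1) := by
      rw [Finset.sum_apply, Finset.sum_eq_single σ]
      · simp only [m, Pi.smul_apply, Pi.single_eq_same]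
        rfl
      · intro τ _ hτ
        simp only [m, Pi.smul_apply,
          Pi.single_eq_of_ne (fun h => hτ (Subtype.ext h.symm) : (σ : Finset (Fin n)) ≠ τ),
          smul_zero]
      · simp
    rw [hg, hsum] at hh
    choose h' hh' using fun j => Ideal.Quotient.mk_surjective (h j)
    have hdiff : b' σ * monomial (w σ) 1 - ∑ j ∈ P \ σ, X j * h' j ∈ I := by
      rw [← Ideal.Quotient.eq, hh, map_sum]
      refine Finset.sum_congr rfl fun j _ => ?_
      rw [← hh' j]
      rfl
    rw [← sub_add_cancel (b' σ * monomial (w σ) 1) (∑ j ∈ P \ σ, X j * h' j)]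
    refine Submodule.add_mem_sup hdiff (Ideal.sum_mem _ fun j hj => ?_)
    exact Ideal.mul_mem_right _ _ (Ideal.subset_span (Set.mem_image_of_mem X hj))
  have := hli.fintype_card_le_finrank
  rwa [Module.finrank_fintype_fun_eq_card, Fintype.card_coe, Finset.card_powersetCard] at this
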